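/- arXiv:2108.00307 — 4 statements merged into one kernel-verified Lean document; each statement's English description precedes it below -/
import Mathlib

section
/- Let p ≥ 2 and d ≥ 1 be integers and let c ∈ 𝒳. Then for all n, j ∈ ℕ^d, the p-fold Cauchy product satisfies (c^p)_{n,j} ≠ 0 only if p·1 ≤ n and n ≤ j ≤ n² − (p−1)(2n − p·1), where all inequalities and arithmetic operations on multi-indices are componentwise. -/
open scoped BigOperators

noncomputable section

/-- Cauchy product of doubly-indexed sequences:
`(a*b)_{n,j} = ∑_{n₁+n₂=n} ∑_{j₁+j₂=j} a_{n₁,j₁} b_{n₂,j₂}`. -/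
def conv2 {d : ℕ} (a b : (Fin d → ℕ) → (Fin d → ℕ) → ℂ) :
    (Fin d → ℕ) → (Fin d → ℕ) → ℂ :=
  fun n j => ∑ k ∈ Finset.Icc 0 n, ∑ l ∈ Finset.Icc 0 j, a k l * b (n - k) (j - l)

/-- `cpow2 a p` is the `p`-fold Cauchy product `a^p`
(with `a^0` the convolution identity). -/
def cpow2 {d : ℕ} (a : (Fin d → ℕ) → (Fin d → ℕ) → ℂ) :
    ℕ → (Fin d → ℕ) → (Fin d → ℕ) → ℂ
  | 0 => fun n j => if n = 0 ∧ j = 0 then 1 else 0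
  | (k + 1) => conv2 a (cpow2 a k)

/-- Membership in `𝒳`: `c_{n,j} ≠ 0` only if `1 ≤ n` and `n ≤ j ≤ n²`
(all componentwise). -/
def memX {d : ℕ} (c : (Fin d → ℕ) → (Fin d → ℕ) → ℂ) : Prop :=
  ∀ n j, c n j ≠ 0 → (1 : Fin d → ℕ) ≤ n ∧ n ≤ j ∧ j ≤ n * n

theorem conv2_ne {d : ℕ} (a b : (Fin d → ℕ) → (Fin d → ℕ) → ℂ) (n j : Fin d → ℕ)
    (h : conv2 a b n j ≠ 0) :
    ∃ k l, k ≤ n ∧ l ≤ j ∧ a k l ≠ 0 ∧ b (n - k) (j - l) ≠ 0 := by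
  unfold conv2 at h
  obtain ⟨k, hk, h⟩ := Finset.exists_ne_zero_of_sum_ne_zero h
  obtain ⟨l, hl, h⟩ := Finset.exists_ne_zero_of_sum_ne_zero h
  exact ⟨k, l, (Finset.mem_Icc.1 hk).2, (Finset.mem_Icc.1 hl).2,
    left_ne_zero_of_mul h, right_ne_zero_of_mul h⟩

theorem cpow2_aux {d : ℕ} (c : (Fin d → ℕ) → (Fin d → ℕ) → ℂ) (hc : memX c) (q : ℕ) :
    ∀ n j : Fin d → ℕ, cpow2 c (q + 1) n j ≠ 0 → ∀ i, q + 1 ≤ n i ∧ n i ≤ j i ∧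
      (j i : ℤ) ≤ ((n i : ℤ) - q) ^ 2 + q := by
  induction q with
  | zero =>
    intro n j h i
    obtain ⟨k, l, hk, hl, h1, h2⟩ := conv2_ne _ _ _ _ h
    obtain ⟨e1, e2, e3⟩ := hc k l h1
    have h3 : n - k = 0 ∧ j - l = 0 := by
      by_contra hn
      exact h2 (if_neg hn)
    have a1 := congrFun h3.1 i
    have a2 := congrFun h3.2 i
    have b1 : k i ≤ n i := hk i
    have b2 : l i ≤ j i := hl i
    have f1 := e1 i
    have f2 : k i ≤ l i := e2 i
    have f3 := e3 i
    simp only [Pi.sub_apply, Pi.zero_apply, Pi.one_apply, Pi.mul_apply] at a1 a2 f1 f3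
    have g1 : n i = k i := by omega
    have g2 : j i = l i := by omega
    rw [g1, g2]
    refine ⟨by omega, f2, ?_⟩
    zify at f3
    push_cast
    nlinarith
  | succ q ih =>
    intro n j h i
    obtain ⟨k, l, hk, hl, h1, h2⟩ := conv2_ne _ _ _ _ h
    obtain ⟨e1, e2, e3⟩ := hc k l h1
    obtain ⟨a1, a2, a3⟩ := ih _ _ h2 i
    have b1 : k i ≤ n i := hk i
    have b2 : l i ≤ j i := hl i
    have f1 := e1 i
    have f2 : k i ≤ l i := e2 i
    have f3 := e3 i
    simp only [Pi.sub_apply, Pi.one_apply, Pi.mul_apply] at a1 a2 a3 f1 f3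
    refine ⟨by omega, by omega, ?_⟩
    obtain ⟨m, hm⟩ := Nat.exists_eq_add_of_le b1
    obtain ⟨r, hr⟩ := Nat.exists_eq_add_of_le b2
    rw [hm, hr] at a2 a3
    rw [hm] at a1
    rw [hm, hr]
    simp only [Nat.add_sub_cancel_left] at a1 a2 a3
    zify at f1 f3 a1
    push_cast
    nlinarith [mul_nonneg (sub_nonneg.2 f1) (sub_nonneg.2 a1)]

/-- If `c ∈ 𝒳` then `(c^p)_{n,j} ≠ 0` only if `p·1 ≤ n` and
`n ≤ j ≤ n² − (p−1)(2n − p·1)`, componentwise. -/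
theorem stmt2 (p d : ℕ) (hp : 2 ≤ p) (hd : 1 ≤ d)
    (c : (Fin d → ℕ) → (Fin d → ℕ) → ℂ) (hc : memX c)
    (n j : Fin d → ℕ) (h : cpow2 c p n j ≠ 0) :
    (∀ i, p ≤ n i) ∧ n ≤ j ∧
      ∀ i, (j i : ℤ) ≤ (n i : ℤ) ^ 2 - ((p : ℤ) - 1) * (2 * (n i : ℤ) - (p : ℤ)) := by
  obtain ⟨q, rfl⟩ : ∃ q, p = q + 1 := ⟨p - 1, by omega⟩
  have H := cpow2_aux c hc q n j h
  refine ⟨fun i => (H i).1, fun i => (H i).2.1, fun i => ?_⟩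
  have h3 := (H i).2.2
  push_cast
  nlinarith
end
end

section
/- Let p ≥ 2 and d ≥ 1 be integers, let ω ∈ ℝ^d have all components ω_i > 0, and let φ : ℕ^d → ℂ satisfy φ_n ≠ 0 only if 1 ≤ n. Then there exists exactly one c ∈ 𝒳 satisfying the recursion (FF). -/
open scoped BigOperators

noncomputable section

/-- `ω²·m = ∑ᵢ ωᵢ² mᵢ`. -/
def wdot {d : ℕ} (ω : Fin d → ℝ) (m : Fin d → ℕ) : ℝ :=
  ∑ i, (ω i) ^ 2 * (m i : ℝ)

/-- The recursion (FF): for every `n` with `1 ≤ n`,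
`c_{n,j} = (c^p)_{n,j} / (ω²·(n²−j))` for `n ≤ j ≤ n²`, `j ≠ n²`, and
`c_{n,n²} = φ_n − ∑_{n ≤ k ≤ n², k ≠ n²} (c^p)_{n,k} / (ω²·(n²−k))`. -/
def FF {d : ℕ} (p : ℕ) (ω : Fin d → ℝ) (φ : (Fin d → ℕ) → ℂ)
    (c : (Fin d → ℕ) → (Fin d → ℕ) → ℂ) : Prop :=
  ∀ n : Fin d → ℕ, (1 : Fin d → ℕ) ≤ n →
    (∀ j, n ≤ j → j ≤ n * n → j ≠ n * n →
      c n j = cpow2 c p n j / ((wdot ω (n * n - j) : ℝ) : ℂ)) ∧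
    c n (n * n) = φ n - ∑ k ∈ (Finset.Icc n (n * n)).erase (n * n),
      cpow2 c p n k / ((wdot ω (n * n - k) : ℝ) : ℂ)

/-- total degree of a multi-index -/
def sdeg {d : ℕ} (n : Fin d → ℕ) : ℕ := ∑ i, n i

lemma sdeg_sub_add {d : ℕ} {k n : Fin d → ℕ} (h : k ≤ n) : sdeg (n - k) + sdeg k = sdeg n := by
  unfold sdeg
  rw [← Finset.sum_add_distrib]
  apply Finset.sum_congr rfl
  intro i _
  have : k i ≤ n i := h i
  simp only [Pi.sub_apply]
  omega

lemma sdeg_pos {d : ℕ} {n : Fin d → ℕ} (h : n ≠ 0) : 0 < sdeg n := by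
  rcases Nat.eq_zero_or_pos (sdeg n) with h0 | h0
  · exfalso
    apply h
    funext i
    exact (Finset.sum_eq_zero_iff.mp h0) i (Finset.mem_univ i)
  · exact h0

lemma cpow2_zero {d : ℕ} {a : (Fin d → ℕ) → (Fin d → ℕ) → ℂ} (ha : a 0 = 0) (q : ℕ) :
    cpow2 a (q + 1) 0 = 0 := by
  funext j
  simp [cpow2, conv2, ha]

lemma cpow2_congr {d : ℕ} {a b : (Fin d → ℕ) → (Fin d → ℕ) → ℂ} (N : ℕ)
    (hab : ∀ k, sdeg k < N → a k = b k) (q : ℕ) :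
    ∀ n, sdeg n < N → cpow2 a q n = cpow2 b q n := by
  induction q with
  | zero => intro n _; rfl
  | succ q ih =>
    intro n hn
    funext j
    simp only [cpow2, conv2]
    apply Finset.sum_congr rfl
    intro k hk
    have h := sdeg_sub_add (Finset.mem_Icc.mp hk).2
    rw [hab k (by omega), ih (n - k) (by omega)]

lemma cpow2_congr' {d : ℕ} {a b : (Fin d → ℕ) → (Fin d → ℕ) → ℂ} (n : Fin d → ℕ)
    (ha : a 0 = 0) (hb : b 0 = 0)
    (hab : ∀ k, sdeg k < sdeg n → a k = b k) (p : ℕ) (hp : 2 ≤ p) :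
    cpow2 a p n = cpow2 b p n := by
  obtain ⟨q, rfl⟩ : ∃ q, p = q + 1 + 1 := ⟨p - 2, by omega⟩
  funext j
  change (∑ k ∈ Finset.Icc 0 n, ∑ l ∈ Finset.Icc 0 j, a k l * cpow2 a (q + 1) (n - k) (j - l)) =
    ∑ k ∈ Finset.Icc 0 n, ∑ l ∈ Finset.Icc 0 j, b k l * cpow2 b (q + 1) (n - k) (j - l)
  apply Finset.sum_congr rfl
  intro k hk
  have hkn := (Finset.mem_Icc.mp hk).2
  have h := sdeg_sub_add hkn
  by_cases h0 : k = 0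
  · simp [h0, ha, hb]
  by_cases h1 : n - k = 0
  · simp [h1, cpow2_zero ha, cpow2_zero hb]
  have := sdeg_pos h0
  have := sdeg_pos h1
  rw [hab k (by omega), cpow2_congr (sdeg n) hab (q + 1) (n - k) (by omega)]

open Classical in
/-- the fixed-point operator of the recursion -/
def TT {d : ℕ} (p : ℕ) (ω : Fin d → ℝ) (φ : (Fin d → ℕ) → ℂ)
    (c : (Fin d → ℕ) → (Fin d → ℕ) → ℂ) : (Fin d → ℕ) → (Fin d → ℕ) → ℂ := fun n j =>
  if (1 : Fin d → ℕ) ≤ n ∧ n ≤ j ∧ j ≤ n * n then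
    if j = n * n then φ n - ∑ k ∈ (Finset.Icc n (n * n)).erase (n * n),
      cpow2 c p n k / ((wdot ω (n * n - k) : ℝ) : ℂ)
    else cpow2 c p n j / ((wdot ω (n * n - j) : ℝ) : ℂ)
  else 0

lemma TT_iff {d : ℕ} (p : ℕ) (ω : Fin d → ℝ) (φ : (Fin d → ℕ) → ℂ)
    (c : (Fin d → ℕ) → (Fin d → ℕ) → ℂ) : (memX c ∧ FF p ω φ c) ↔ TT p ω φ c = c := by
  constructor
  · rintro ⟨hX, hF⟩
    funext n j
    unfold TT
    split_ifs with h1 h2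
    · rw [h2, (hF n h1.1).2]
    · rw [(hF n h1.1).1 j h1.2.1 h1.2.2 h2]
    · by_contra h
      exact h1 (hX n j (Ne.symm h))
  · intro h
    constructor
    · intro n j hne
      by_contra hc
      apply hne
      rw [← h]
      simp only [TT]
      rw [if_neg hc]
    · intro n hn
      constructor
      · intro j h1 h2 h3
        conv_lhs => rw [← h]
        simp only [TT]
        rw [if_pos ⟨hn, h1, h2⟩, if_neg h3]
      · conv_lhs => rw [← h]
        simp only [TT]
        have : n ≤ n * n := fun i => Nat.le_mul_of_pos_left _ (hn i)
        rw [if_pos ⟨hn, this, le_rfl⟩, if_pos trivial]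

lemma TT_zero {d : ℕ} (hd : 1 ≤ d) (p : ℕ) (ω : Fin d → ℝ) (φ : (Fin d → ℕ) → ℂ)
    (c : (Fin d → ℕ) → (Fin d → ℕ) → ℂ) : TT p ω φ c 0 = 0 := by
  funext j
  unfold TT
  rw [if_neg]
  · rfl
  · rintro ⟨h, _⟩
    have := h ⟨0, hd⟩
    simp at this

lemma TT_congr {d : ℕ} (p : ℕ) (hp : 2 ≤ p) (ω : Fin d → ℝ) (φ : (Fin d → ℕ) → ℂ)
    {a b : (Fin d → ℕ) → (Fin d → ℕ) → ℂ} (n : Fin d → ℕ)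
    (ha : a 0 = 0) (hb : b 0 = 0)
    (hab : ∀ k, sdeg k < sdeg n → a k = b k) : TT p ω φ a n = TT p ω φ b n := by
  funext j
  simp only [TT, cpow2_congr' n ha hb hab p hp]

/-- Existence and uniqueness of the element of `𝒳` satisfying the recursion (FF). -/
theorem stmt3 (p d : ℕ) (hp : 2 ≤ p) (hd : 1 ≤ d)
    (ω : Fin d → ℝ) (hω : ∀ i, 0 < ω i)
    (φ : (Fin d → ℕ) → ℂ) (hφ : ∀ n, φ n ≠ 0 → (1 : Fin d → ℕ) ≤ n) :
    ∃! c : (Fin d → ℕ) → (Fin d → ℕ) → ℂ, memX c ∧ FF p ω φ c := by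
  simp only [TT_iff]
  have hz : ∀ N, ((TT p ω φ)^[N] 0) 0 = 0 := by
    intro N
    cases N with
    | zero => rfl
    | succ N => rw [Function.iterate_succ_apply']; exact TT_zero hd p ω φ _
  have hstep : ∀ N n, sdeg n < N → ((TT p ω φ)^[N + 1] 0) n = ((TT p ω φ)^[N] 0) n := by
    intro N
    induction N with
    | zero => intro n hn; omega
    | succ N ih =>
      intro n hn
      have e1 := Function.iterate_succ_apply' (TT p ω φ) (N + 1) 0
      have e2 := Function.iterate_succ_apply' (TT p ω φ) N 0
      refine (congrFun e1 n).trans (Eq.trans ?_ (congrFun e2 n).symm)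
      exact TT_congr p hp ω φ n (hz _) (hz _) (fun k hk => ih k (by omega))
  have hmono : ∀ n M, ((TT p ω φ)^[sdeg n + 1 + M] 0) n = ((TT p ω φ)^[sdeg n + 1] 0) n := by
    intro n M
    induction M with
    | zero => rfl
    | succ M ih => rw [← ih, ← add_assoc]; exact hstep _ n (by omega)
  refine ⟨fun n => ((TT p ω φ)^[sdeg n + 1] 0) n, ?_, ?_⟩
  · funext n
    rw [Function.iterate_succ_apply']
    apply TT_congr p hp ω φ n
    · exact hz _
    · exact hz _
    · intro k hk
      obtain ⟨M, hM⟩ := Nat.exists_eq_add_of_lt hk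
      have h2 : sdeg n = sdeg k + 1 + M := by omega
      rw [h2]
      exact (hmono k M).symm
  · intro b hb
    have hb0 : b 0 = 0 := by rw [← hb]; exact TT_zero hd p ω φ _
    have key : ∀ N n, sdeg n < N → b n = ((TT p ω φ)^[N] 0) n := by
      intro N
      induction N with
      | zero => intro n hn; omega
      | succ N ih =>
        intro n hn
        rw [Function.iterate_succ_apply']
        conv_lhs => rw [← hb]
        exact TT_congr p hp ω φ n hb0 (hz _) (fun k hk => ih k (by omega))
    funext n
    rw [key (sdeg n + 1) n (by omega)]
end
end

section
/- (Radii polynomial / Newton–Kantorovich theorem.) Let X be a Banach space, ĉ ∈ X, and T : X → X a Fréchet differentiable mapping. Suppose Y₀ > 0 and Z₁ ≥ 0 are constants and Z₂ : (0,∞) → [0,∞) is a function such that ‖T(ĉ) − ĉ‖ ≤ Y₀ and, for every r > 0, sup_{‖c‖ ≤ r} ‖DT(ĉ + c)‖ ≤ Z₁ + Z₂(r)·r (operator norm of the Fréchet derivative). If there exists r > 0 such that Z₂(r)·r² − (1 − Z₁)·r + Y₀ ≤ 0, then there exists a unique c̃ in the closed ball of radius r centered at ĉ with T(c̃) = c̃.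 -/
/-- Radii polynomial / Newton–Kantorovich theorem: if `T : X → X` is Fréchet
differentiable on a Banach space `X`, `‖T(ĉ) − ĉ‖ ≤ Y₀`, and for every `r > 0` the
derivative satisfies `sup_{‖c‖ ≤ r} ‖DT(ĉ + c)‖ ≤ Z₁ + Z₂(r)·r`, then any `r > 0` with
`Z₂(r)r² − (1 − Z₁)r + Y₀ ≤ 0` yields a unique fixed point of `T` in the closed ball of
radius `r` about `ĉ`. -/
theorem stmt12 {X : Type*} [NormedAddCommGroup X] [NormedSpace ℝ X] [CompleteSpace X]
    (T : X → X) (DT : X → X →L[ℝ] X) (hT : ∀ x : X, HasFDerivAt T (DT x) x)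
    (chat : X) (Y₀ Z₁ : ℝ) (hY₀ : 0 < Y₀) (hZ₁ : 0 ≤ Z₁)
    (Z₂ : ℝ → ℝ) (hZ₂ : ∀ r : ℝ, 0 < r → 0 ≤ Z₂ r)
    (hY : ‖T chat - chat‖ ≤ Y₀)
    (hZ : ∀ r : ℝ, 0 < r → ∀ c : X, ‖c‖ ≤ r → ‖DT (chat + c)‖ ≤ Z₁ + Z₂ r * r)
    (r : ℝ) (hr : 0 < r) (hP : Z₂ r * r ^ 2 - (1 - Z₁) * r + Y₀ ≤ 0) :
    ∃! ctil : X, ctil ∈ Metric.closedBall chat r ∧ T ctil = ctil := by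
  have hk0 : 0 ≤ Z₁ + Z₂ r * r := add_nonneg hZ₁ (mul_nonneg (hZ₂ r hr) hr.le)
  obtain ⟨k, hk⟩ : ∃ k, k = Z₁ + Z₂ r * r := ⟨_, rfl⟩
  have hkr : k * r + Y₀ ≤ r := by rw [hk]; nlinarith
  have hk1 : k < 1 := by
    by_contra h
    nlinarith [not_lt.mp h]
  rw [← hk] at hk0
  have hlip : ∀ x ∈ Metric.closedBall chat r, ∀ y ∈ Metric.closedBall chat r,
      ‖T y - T x‖ ≤ k * ‖y - x‖ := by
    intro x hx y hy
    refine (convex_closedBall chat r).norm_image_sub_le_of_norm_hasFDerivWithin_le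
      (fun z _ => (hT z).hasFDerivWithinAt) (fun z hz => ?_) hx hy
    have h := hZ r hr (z - chat) (by simpa [dist_eq_norm] using hz)
    rw [add_sub_cancel] at h
    exact h.trans hk.ge
  have hc : chat ∈ Metric.closedBall chat r := Metric.mem_closedBall_self hr.le
  have hmaps : Set.MapsTo T (Metric.closedBall chat r) (Metric.closedBall chat r) := by
    intro x hx
    have h1 := hlip chat hc x hx
    have h2 : ‖x - chat‖ ≤ r := by simpa [dist_eq_norm] using hx
    have h3 := norm_sub_le_norm_sub_add_norm_sub (T x) (T chat) chat
    rw [Metric.mem_closedBall, dist_eq_norm]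
    have h4 := mul_le_mul_of_nonneg_left h2 hk0
    linarith
  have hcon : ContractingWith ⟨k, hk0⟩ (hmaps.restrict T _ _) := by
    refine ⟨by exact_mod_cast hk1, LipschitzWith.of_dist_le_mul fun x y => ?_⟩
    have h := hlip y y.2 x x.2
    rw [← dist_eq_norm, ← dist_eq_norm] at h
    exact h
  obtain ⟨y, hy, hfix, -⟩ := ContractingWith.exists_fixedPoint'
    Metric.isClosed_closedBall.isComplete hmaps hcon hc (edist_ne_top _ _)
  refine ⟨y, ⟨hy, hfix⟩, ?_⟩
  rintro z ⟨hz, hzf⟩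
  have h := hlip y hy z hz
  rw [hzf, hfix.eq] at h
  have h0 : ‖z - y‖ = 0 := by
    have := norm_nonneg (z - y)
    nlinarith
  exact sub_eq_zero.mp (norm_eq_zero.mp h0)
end

section
/- Let p ≥ 2 be an integer, let I ⊆ ℝ be an interval, and let z : I → ℂ be differentiable with z(t) ≠ 0 for all t ∈ I and z'(t) = −i z(t)^p for all t ∈ I. Then the function t ↦ z(t)^{−(p−1)} + conj(z(t))^{−(p−1)} is constant on I; i.e., the singular functional V(z) = 1/z^{p−1} + 1/z̄^{p−1} is conserved along nonvanishing solutions of the ODE i ż = z^p. -/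
/-- The singular functional `V(z) = 1/z^{p−1} + 1/z̄^{p−1}` is conserved along
nonvanishing solutions of the ODE `i ż = z^p` on an interval `I ⊆ ℝ`. -/
theorem stmt17 (p : ℕ) (hp : 2 ≤ p) (I : Set ℝ) (hI : I.OrdConnected)
    (z : ℝ → ℂ) (hz0 : ∀ t ∈ I, z t ≠ 0)
    (hz : ∀ t ∈ I, HasDerivWithinAt z (-Complex.I * z t ^ p) I t) :
    ∀ s ∈ I, ∀ t ∈ I,
      (z s ^ (p - 1))⁻¹ + ((starRingEnd ℂ) (z s) ^ (p - 1))⁻¹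
        = (z t ^ (p - 1))⁻¹ + ((starRingEnd ℂ) (z t) ^ (p - 1))⁻¹ := by
  obtain ⟨n, rfl⟩ : ∃ n, p = n + 2 := ⟨p - 2, by omega⟩
  have hpn : n + 2 - 1 = n + 1 := by omega
  rw [hpn]
  have hw : ∀ t ∈ I, HasDerivWithinAt (fun t => (z t ^ (n + 1))⁻¹)
      (((n : ℂ) + 1) * Complex.I) I t := by
    intro t ht
    have h0 := hz0 t ht
    have h := ((hz t ht).fun_pow (n + 1)).fun_inv (pow_ne_zero _ h0)
    refine h.congr_deriv ?_
    rw [div_eq_iff (pow_ne_zero _ (pow_ne_zero _ h0))]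
    simp only [Nat.add_sub_cancel]
    push_cast
    ring
  have hV : ∀ t ∈ I, HasDerivWithinAt
      (fun t => (z t ^ (n + 1))⁻¹ + ((starRingEnd ℂ) (z t) ^ (n + 1))⁻¹) 0 I t := by
    intro t ht
    have h := (hw t ht).fun_add (hw t ht).star
    have e : (fun t => (z t ^ (n + 1))⁻¹ + ((starRingEnd ℂ) (z t) ^ (n + 1))⁻¹)
        = fun t => (z t ^ (n + 1))⁻¹ + star ((z t ^ (n + 1))⁻¹) := by
      funext t
      simp
    rw [e]
    refine h.congr_deriv ?_
    simp
  intro s hs t ht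
  have h := hI.convex.norm_image_sub_le_of_norm_hasDerivWithin_le (C := 0) hV
    (fun x _ => by simp) ht hs
  rw [zero_mul, norm_le_zero_iff, sub_eq_zero] at h
  exact h
end
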